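/- (Inverse Composition Theorem, integral identity.) Let Ω, Ω' ⊆ ℝ² be open, let 1 < q < p < ∞, and let p', q' be the conjugate exponents, 1/p + 1/p' = 1 and 1/q + 1/q' = 1. Let φ : Ω → Ω' be a C¹ diffeomorphism whose Jacobian determinant J(z, φ) is nonzero everywhere. Then ∫_{Ω'} (‖D(φ⁻¹)(w)‖^{q'} / |J(w, φ⁻¹)|)^{p'/(q'−p')} dμ(w) = ∫_Ω (‖Dφ(z)‖^{p} / |J(z, φ)|)^{q/(p−q)} dμ(z), as an equality of integrals with values in [0, ∞]. In particular, K_{p,q}(φ; Ω) < ∞ if and only if K_{q',p'}(φ⁻¹; Ω') < ∞. -/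

import Mathlib

open MeasureTheory Set
open scoped ENNReal

/-- In the plane, `|det A| ‖u‖ ≤ ‖A‖ ‖A u‖`: compare the areas of the square spanned by `u` and
its rotation by a right angle, and of its image under `A`. -/
theorem abs_det_mul_norm_le
    (A : EuclideanSpace ℝ (Fin 2) →L[ℝ] EuclideanSpace ℝ (Fin 2)) (u : EuclideanSpace ℝ (Fin 2)) :
    |A.det| * ‖u‖ ≤ ‖A‖ * ‖A u‖ := by
  rcases eq_or_ne u 0 with rfl | hu
  · simp
  have hu' : 0 < ‖u‖ := norm_pos_iff.mpr hu
  set v : EuclideanSpace ℝ (Fin 2) := !₂[-u 1, u 0] with hv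
  have hsq : ∀ x : EuclideanSpace ℝ (Fin 2), ‖x‖ ^ 2 = x 0 ^ 2 + x 1 ^ 2 := fun x => by
    simp [EuclideanSpace.norm_sq_eq, Fin.sum_univ_two]
  have hvn : ‖v‖ = ‖u‖ := by
    rw [← sq_eq_sq₀ (norm_nonneg _) (norm_nonneg _), hsq, hsq]
    simp [hv]
    ring
  set e := EuclideanSpace.basisFun (Fin 2) ℝ with he
  have hdet : A.det = A (e 0) 0 * A (e 1) 1 - A (e 1) 0 * A (e 0) 1 := by
    rw [ContinuousLinearMap.det, ← LinearMap.det_toMatrix e.toBasis, Matrix.det_fin_two]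
    simp [LinearMap.toMatrix_apply, he]
  have hA : ∀ (x : EuclideanSpace ℝ (Fin 2)) i, A x i = x 0 * A (e 0) i + x 1 * A (e 1) i := by
    intro x i
    have hx : x = x 0 • e 0 + x 1 • e 1 := by
      ext j
      fin_cases j <;> simp [he]
    conv_lhs => rw [hx]
    simp
  have harea : A.det * ‖u‖ ^ 2 = A u 0 * A v 1 - A v 0 * A u 1 := by
    rw [hsq, hdet, hA u, hA u, hA v, hA v]
    simp only [hv, PiLp.toLp_apply, Matrix.cons_val_zero, Matrix.cons_val_one]
    ring
  have hcs : |A.det| * ‖u‖ ^ 2 ≤ ‖A u‖ * ‖A v‖ := by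
    rw [← abs_of_nonneg (sq_nonneg ‖u‖), ← abs_mul, harea]
    refine abs_le_of_sq_le_sq ?_ (by positivity)
    rw [mul_pow, hsq, hsq]
    nlinarith [sq_nonneg (A u 0 * A v 0 + A u 1 * A v 1)]
  have hle : ‖A v‖ ≤ ‖A‖ * ‖u‖ := hvn ▸ A.le_opNorm v
  have h := hcs.trans (mul_le_mul_of_nonneg_left hle (norm_nonneg (A u)))
  refine le_of_mul_le_mul_right ?_ hu'
  linarith

theorem abs_det_mul_norm_inverse_le
    (A B : EuclideanSpace ℝ (Fin 2) →L[ℝ] EuclideanSpace ℝ (Fin 2))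
    (hAB : A.comp B = ContinuousLinearMap.id ℝ _) : |A.det| * ‖B‖ ≤ ‖A‖ := by
  rcases eq_or_ne A.det 0 with h0 | h0
  · simp [h0]
  have hpos : 0 < |A.det| := abs_pos.mpr h0
  rw [mul_comm, ← le_div_iff₀ hpos]
  refine B.opNorm_le_bound (by positivity) fun v => ?_
  have h := abs_det_mul_norm_le A (B v)
  rw [show A (B v) = v from DFunLike.congr_fun hAB v] at h
  rw [div_mul_eq_mul_div, le_div_iff₀ hpos]
  linarith

/-- In the plane, `‖A⁻¹‖ = ‖A‖ / |det A|`. -/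
theorem norm_inverse_eq_norm_div_abs_det
    (A B : EuclideanSpace ℝ (Fin 2) →L[ℝ] EuclideanSpace ℝ (Fin 2))
    (hAB : A.comp B = ContinuousLinearMap.id ℝ _) (hBA : B.comp A = ContinuousLinearMap.id ℝ _)
    (hdet : A.det * B.det = 1) : ‖B‖ = ‖A‖ / |A.det| := by
  have h0 : A.det ≠ 0 := left_ne_zero_of_mul_eq_one hdet
  have hpos : 0 < |A.det| := abs_pos.mpr h0
  have habs : |A.det| * |B.det| = 1 := by rw [← abs_mul, hdet, abs_one]
  rw [eq_div_iff hpos.ne']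
  refine le_antisymm ?_ ?_
  · linarith [abs_det_mul_norm_inverse_le A B hAB]
  · calc ‖A‖ = |A.det| * (|B.det| * ‖A‖) := by rw [← mul_assoc, habs, one_mul]
      _ ≤ |A.det| * ‖B‖ := by gcongr; exact abs_det_mul_norm_inverse_le B A hBA
      _ = ‖B‖ * |A.det| := mul_comm _ _

/-- The dual distortion density of the inverse, multiplied by the Jacobian `j`, is the distortion
density. -/
theorem mul_dual_distortion_eq {p q p' q' a j : ℝ} (hq1 : 1 < q) (hqp : q < p)
    (hp' : 1 / p + 1 / p' = 1) (hq' : 1 / q + 1 / q' = 1) (ha : 0 < a) (hj : 0 < j) :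
    j * ((a / j) ^ q' / j⁻¹) ^ (p' / (q' - p')) = (a ^ p / j) ^ (q / (p - q)) := by
  have hpq : p - q ≠ 0 := (sub_pos.mpr hqp).ne'
  have hconj : ∀ {s s' : ℝ}, 1 < s → 1 / s + 1 / s' = 1 → s' = s / (s - 1) := by
    intro s s' hs h
    have hs0 : s ≠ 0 := by positivity
    have hs1 : s - 1 ≠ 0 := (sub_pos.mpr hs).ne'
    have hs' : s' ≠ 0 := by
      rintro rfl
      field_simp at h
      simp at h
      linarith
    field_simp at h ⊢
    linarith
  have hp1 : p - 1 ≠ 0 := by linarith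
  have hq1' : q - 1 ≠ 0 := by linarith
  have hp0 : p ≠ 0 := by linarith
  have hexp : p' / (q' - p') = p * (q - 1) / (p - q) := by
    rw [hconj (hq1.trans hqp) hp', hconj hq1 hq',
      show q / (q - 1) - p / (p - 1) = (p - q) / ((q - 1) * (p - 1)) by field_simp; ring]
    field_simp
  rw [hexp, hconj hq1 hq']
  refine Real.log_injOn_pos (Set.mem_Ioi.mpr (by positivity)) (Set.mem_Ioi.mpr (by positivity)) ?_
  rw [Real.log_mul hj.ne' (by positivity), Real.log_rpow (by positivity),
    Real.log_div (by positivity) (by positivity), Real.log_rpow (by positivity),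
    Real.log_div ha.ne' hj.ne', Real.log_inv, Real.log_rpow (by positivity),
    Real.log_div (by positivity) hj.ne', Real.log_rpow ha]
  field_simp
  ring

/-- **Inverse Composition Theorem, integral identity.** Let `1 < q < p < ∞`
with conjugate exponents `p'`, `q'`, and let `φ : Ω → Ω'` be a `C¹` diffeomorphism between
open subsets of `ℝ²` with nonvanishing Jacobian. Then
`∫_{Ω'} (‖D(φ⁻¹)(w)‖^{q'} / |J(w, φ⁻¹)|)^{p'/(q'−p')} dμ
  = ∫_Ω (‖Dφ(z)‖^p / |J(z, φ)|)^{q/(p−q)} dμ` in `[0, ∞]`; in particular one side is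
finite iff the other is. -/
theorem inverse_composition_integral_identity
    (Ω Ω' : Set (EuclideanSpace ℝ (Fin 2)))
    (hΩ : IsOpen Ω) (hΩ' : IsOpen Ω')
    (p q p' q' : ℝ) (hq1 : 1 < q) (hqp : q < p)
    (hp' : 1 / p + 1 / p' = 1) (hq' : 1 / q + 1 / q' = 1)
    (φ ψ : EuclideanSpace ℝ (Fin 2) → EuclideanSpace ℝ (Fin 2))
    (hφ : ContDiffOn ℝ 1 φ Ω) (hbij : Set.BijOn φ Ω Ω')
    (hinv : Set.InvOn ψ φ Ω Ω') (hψ : ContDiffOn ℝ 1 ψ Ω')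
    (hJ : ∀ z ∈ Ω, (fderiv ℝ φ z).det ≠ 0) :
    (∫⁻ w in Ω', ENNReal.ofReal
        ((‖fderiv ℝ ψ w‖ ^ q' / |(fderiv ℝ ψ w).det|) ^ (p' / (q' - p'))) ∂volume
      = ∫⁻ z in Ω, ENNReal.ofReal
          ((‖fderiv ℝ φ z‖ ^ p / |(fderiv ℝ φ z).det|) ^ (q / (p - q))) ∂volume) ∧
    ((∫⁻ z in Ω, ENNReal.ofReal
        ((‖fderiv ℝ φ z‖ ^ p / |(fderiv ℝ φ z).det|) ^ (q / (p - q))) ∂volume) < ⊤ ↔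
      (∫⁻ w in Ω', ENNReal.ofReal
        ((‖fderiv ℝ ψ w‖ ^ q' / |(fderiv ℝ ψ w).det|) ^ (p' / (q' - p'))) ∂volume) < ⊤) := by
  have key : ∫⁻ w in Ω', ENNReal.ofReal
        ((‖fderiv ℝ ψ w‖ ^ q' / |(fderiv ℝ ψ w).det|) ^ (p' / (q' - p'))) ∂volume
      = ∫⁻ z in Ω, ENNReal.ofReal
          ((‖fderiv ℝ φ z‖ ^ p / |(fderiv ℝ φ z).det|) ^ (q / (p - q))) ∂volume := by
    have hφd : ∀ z ∈ Ω, HasFDerivAt φ (fderiv ℝ φ z) z := fun z hz =>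
      ((hφ.differentiableOn one_ne_zero).differentiableAt (hΩ.mem_nhds hz)).hasFDerivAt
    have hψd : ∀ w ∈ Ω', HasFDerivAt ψ (fderiv ℝ ψ w) w := fun w hw =>
      ((hψ.differentiableOn one_ne_zero).differentiableAt (hΩ'.mem_nhds hw)).hasFDerivAt
    rw [← hbij.image_eq, lintegral_image_eq_lintegral_abs_det_fderiv_mul volume hΩ.measurableSet
      (fun z hz => (hφd z hz).hasFDerivWithinAt) hbij.injOn]
    refine setLIntegral_congr_fun hΩ.measurableSet fun z hz => ?_
    have hw : φ z ∈ Ω' := hbij.mapsTo hz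
    have hψφ : ψ (φ z) = z := hinv.1 hz
    have hBA : (fderiv ℝ ψ (φ z)).comp (fderiv ℝ φ z) = ContinuousLinearMap.id ℝ _ :=
      ((hψd _ hw).comp z (hφd z hz)).unique <| (hasFDerivAt_id z).congr_of_eventuallyEq <|
        Filter.eventuallyEq_of_mem (hΩ.mem_nhds hz) hinv.1
    have hAB : (fderiv ℝ φ z).comp (fderiv ℝ ψ (φ z)) = ContinuousLinearMap.id ℝ _ :=
      (HasFDerivAt.comp (φ z) (hψφ.symm ▸ hφd z hz) (hψd _ hw)).unique <|
        (hasFDerivAt_id (φ z)).congr_of_eventuallyEq <|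
          Filter.eventuallyEq_of_mem (hΩ'.mem_nhds hw) hinv.2
    set A := fderiv ℝ φ z
    set B := fderiv ℝ ψ (φ z)
    have hdet : A.det * B.det = 1 := by
      have h := congrArg ContinuousLinearMap.det hAB
      simpa [ContinuousLinearMap.det] using h
    have hj : 0 < |A.det| := abs_pos.mpr (hJ z hz)
    have ha : 0 < ‖A‖ := by
      rw [norm_pos_iff]
      intro h
      have := DFunLike.congr_fun hAB (EuclideanSpace.single 0 1)
      simp [h] at this
      simpa using congrArg (fun x => x 0) this
    have hB : |B.det| = |A.det|⁻¹ :=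
      eq_inv_of_mul_eq_one_right (by rw [← abs_mul, hdet, abs_one])
    rw [← ENNReal.ofReal_mul hj.le, norm_inverse_eq_norm_div_abs_det A B hAB hBA hdet, hB,
      mul_dual_distortion_eq hq1 hqp hp' hq' ha hj]
  exact ⟨key, by rw [key]⟩
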